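/- For every integer n ≥ 2, the map (i, j) ↦ F_{4n}·i + L_{2n}·j, with 0 ≤ i ≤ L_{2n+1} − 2 and 0 ≤ j ≤ F_{2n} − 1, is a bijection onto the set of multiples k·L_{2n} with 0 ≤ k ≤ F_{4n+1} − F_{2n} − 2; that is, each such multiple is represented exactly once. -/

import Mathlib

/-- The Lucas numbers: `L_0 = 2`, `L_1 = 1`, `L_n = L_{n-1} + L_{n-2}`. -/
def lucas : ℕ → ℕ
  | 0 => 2
  | 1 => 1
  | n + 2 => lucas (n + 1) + lucas n

theorem lucas_add_fib (m : ℕ) : lucas m + Nat.fib m = 2 * Nat.fib (m + 1) := by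
  induction m using Nat.twoStepInduction with
  | zero => simp [lucas]
  | one => simp [lucas]
  | more m h₀ h₁ =>
    have e₁ : Nat.fib (m + 2) = Nat.fib m + Nat.fib (m + 1) := Nat.fib_add_two
    have e₂ : Nat.fib (m + 2 + 1) = Nat.fib (m + 1) + Nat.fib (m + 2) := Nat.fib_add_two
    rw [add_assoc m 1 1, one_add_one_eq_two] at h₁
    rw [lucas]
    omega

theorem lucas_succ (m : ℕ) : lucas (m + 1) = 2 * Nat.fib m + Nat.fib (m + 1) := by
  have h := lucas_add_fib (m + 1)
  rw [add_assoc m 1 1, Nat.fib_add_two] at h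
  omega

theorem fib_two_mul_eq_fib_mul_lucas (m : ℕ) :
    Nat.fib (2 * m) = Nat.fib m * lucas m := by
  rw [Nat.fib_two_mul, ← lucas_add_fib, Nat.add_sub_cancel]

/-- Cassini's identity at even indices, without subtraction. -/
theorem fib_even_cassini (n : ℕ) :
    Nat.fib (2 * n + 1) ^ 2 =
      Nat.fib (2 * n) * Nat.fib (2 * n + 1) + Nat.fib (2 * n) ^ 2 + 1 := by
  induction n with
  | zero => simp
  | succ n ih =>
    have e₁ := Nat.fib_add_two (n := 2 * n)
    have e₂ := Nat.fib_add_two (n := 2 * n + 1)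
    rw [show 2 * (n + 1) = 2 * n + 2 by ring, e₂, e₁]
    linarith

theorem fib_four_mul_add_one (n : ℕ) :
    Nat.fib (4 * n + 1) = Nat.fib (2 * n) * lucas (2 * n + 1) + 1 := by
  rw [show 4 * n + 1 = 2 * (2 * n) + 1 by ring, Nat.fib_two_mul_add_one, lucas_succ,
    fib_even_cassini]
  ring

/-- Division with remainder by `a`, as a bijection onto an initial segment of `ℕ`. -/
theorem bijOn_mul_add {a : ℕ} (ha : 0 < a) (b : ℕ) :
    Set.BijOn (fun p : ℕ × ℕ => a * p.1 + p.2) (Set.Iio b ×ˢ Set.Iio a) (Set.Iio (a * b)) := by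
  refine ⟨?_, ?_, ?_⟩
  · rintro ⟨i, j⟩ ⟨hi, hj⟩
    simp only [Set.mem_Iio] at *
    calc a * i + j < a * (i + 1) := by rw [mul_add, mul_one]; omega
      _ ≤ a * b := Nat.mul_le_mul_left a hi
  · rintro ⟨i, j⟩ ⟨-, hj⟩ ⟨i', j'⟩ ⟨-, hj'⟩ h
    simp only [Set.mem_Iio] at hj hj' h
    have hdiv := congrArg (· / a) h
    have hmod := congrArg (· % a) h
    simp only [Nat.mul_add_div ha, Nat.div_eq_of_lt hj, Nat.div_eq_of_lt hj', add_zero] at hdiv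
    simp only [Nat.mul_add_mod, Nat.mod_eq_of_lt hj, Nat.mod_eq_of_lt hj'] at hmod
    rw [hdiv, hmod]
  · intro k hk
    exact ⟨(k / a, k % a), ⟨Nat.div_lt_of_lt_mul hk, Nat.mod_lt k ha⟩, Nat.div_add_mod k a⟩

/-- For `n ≥ 2`, the map `(i,j) ↦ F_{4n}·i + L_{2n}·j` on
`{0, …, L_{2n+1} - 2} × {0, …, F_{2n} - 1}` is a bijection onto the set of multiples
`k·L_{2n}` for `0 ≤ k ≤ F_{4n+1} - F_{2n} - 2`. -/
theorem mixed_radix_bijection (n : ℕ) (hn : 2 ≤ n) :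
    Set.BijOn (fun p : ℕ × ℕ => Nat.fib (4 * n) * p.1 + lucas (2 * n) * p.2)
      (Set.Iic (lucas (2 * n + 1) - 2) ×ˢ Set.Iic (Nat.fib (2 * n) - 1))
      {m : ℕ | ∃ k : ℕ, k ≤ Nat.fib (4 * n + 1) - Nat.fib (2 * n) - 2 ∧
        m = k * lucas (2 * n)} := by
  have ha : 0 < Nat.fib (2 * n) := Nat.fib_pos.2 (by omega)
  have hb : 0 < Nat.fib (2 * n + 1) := Nat.fib_pos.2 (by omega)
  have hL : 0 < lucas (2 * n) := by
    have h₁ := lucas_add_fib (2 * n)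
    have h₂ := Nat.fib_le_fib_succ (n := 2 * n)
    omega
  have hL' : 2 ≤ lucas (2 * n + 1) := by
    have h := lucas_succ (2 * n)
    omega
  have hdom : Set.Iic (lucas (2 * n + 1) - 2) ×ˢ Set.Iic (Nat.fib (2 * n) - 1) =
      Set.Iio (lucas (2 * n + 1) - 1) ×ˢ Set.Iio (Nat.fib (2 * n)) := by
    ext ⟨i, j⟩
    simp only [Set.mem_prod, Set.mem_Iic, Set.mem_Iio]
    omega
  have hfun : (fun p : ℕ × ℕ => Nat.fib (4 * n) * p.1 + lucas (2 * n) * p.2) =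
      (fun k => k * lucas (2 * n)) ∘ (fun p : ℕ × ℕ => Nat.fib (2 * n) * p.1 + p.2) := by
    funext p
    simp only [Function.comp_apply]
    rw [show 4 * n = 2 * (2 * n) by ring, fib_two_mul_eq_fib_mul_lucas]
    ring
  have hcod : {m : ℕ | ∃ k : ℕ, k ≤ Nat.fib (4 * n + 1) - Nat.fib (2 * n) - 2 ∧
      m = k * lucas (2 * n)} =
      (fun k => k * lucas (2 * n)) ''
        Set.Iio (Nat.fib (2 * n) * (lucas (2 * n + 1) - 1)) := by
    have hpos : 0 < Nat.fib (2 * n) * (lucas (2 * n + 1) - 1) :=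
      Nat.mul_pos ha (by omega)
    have hbound := fib_four_mul_add_one n
    ext m
    simp only [Set.mem_ofPred_eq, Set.mem_image, Set.mem_Iio, eq_comm (a := m)]
    refine exists_congr fun k => and_congr_left fun _ => ?_
    rw [Nat.mul_sub_one] at hpos ⊢
    omega
  rw [hdom, hfun, hcod]
  exact ((mul_left_injective₀ hL.ne').injOn.bijOn_image).comp (bijOn_mul_add ha _)
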